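/- Let R(q) = (q,q^4;q^5)_∞/(q^2,q^3;q^5)_∞ and E(q)=(q;q)_∞. Then 1/(R(q) R(q^4)) - q^2 R(q) R(q^4) = E(q^2)^3 E(q^{10})^5/(E(q) E(q^4) E(q^5)^3 E(q^{20})^3). -/

import Mathlib

/-- Euler's product E(q) = ∏_{k≥0} (1 - q^{k+1}). -/
noncomputable def E (q : ℂ) : ℂ := ∏' k : ℕ, (1 - q ^ (k + 1))

/-- q-Pochhammer infinite product (a;q)_∞ = ∏_{k≥0} (1 - a q^k). -/
noncomputable def qp (a q : ℂ) : ℂ := ∏' k : ℕ, (1 - a * q ^ k)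

/-- Rogers–Ramanujan function G(q) = 1/((q,q^4;q^5)_∞). -/
noncomputable def G (q : ℂ) : ℂ := 1 / (qp q (q ^ 5) * qp (q ^ 4) (q ^ 5))

/-- Rogers–Ramanujan function H(q) = 1/((q^2,q^3;q^5)_∞). -/
noncomputable def H (q : ℂ) : ℂ := 1 / (qp (q ^ 2) (q ^ 5) * qp (q ^ 3) (q ^ 5))

/-- Rogers–Ramanujan continued fraction product R(q). -/
noncomputable def R (q : ℂ) : ℂ :=
  (qp q (q ^ 5) * qp (q ^ 4) (q ^ 5)) / (qp (q ^ 2) (q ^ 5) * qp (q ^ 3) (q ^ 5))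


open Filter Topology Finset

section Pochhammer

theorem norm_pow_lt_one {q : ℂ} (hq : ‖q‖ < 1) {n : ℕ} (hn : n ≠ 0) : ‖q ^ n‖ < 1 := by
  rw [norm_pow]
  exact pow_lt_one₀ (norm_nonneg q) hq hn

theorem summable_norm_qp {q : ℂ} (a : ℂ) (hq : ‖q‖ < 1) :
    Summable fun k : ℕ => ‖-(a * q ^ k)‖ := by
  simpa [norm_mul, norm_pow] using
    (summable_geometric_of_lt_one (norm_nonneg q) hq).mul_left ‖a‖

theorem multipliable_qp {q : ℂ} (a : ℂ) (hq : ‖q‖ < 1) :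
    Multipliable fun k : ℕ => 1 - a * q ^ k := by
  simpa [sub_eq_add_neg] using multipliable_one_add_of_summable (summable_norm_qp a hq)

theorem E_eq_qp (q : ℂ) : E q = qp q q := by
  simp only [E, qp, pow_succ']

theorem qp_ne_zero {a q : ℂ} (ha : ‖a‖ < 1) (hq : ‖q‖ < 1) : qp a q ≠ 0 := by
  have h := tprod_one_add_ne_zero_of_summable (f := fun k : ℕ => -(a * q ^ k)) (fun k h0 => ?_)
    (summable_norm_qp a hq)
  · simpa [qp, sub_eq_add_neg] using h
  · have h1 : a * q ^ k = 1 := by linear_combination -h0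
    have h2 : ‖a‖ * ‖q‖ ^ k = 1 := by rw [← norm_pow, ← norm_mul, h1, norm_one]
    have h3 : ‖q‖ ^ k ≤ 1 := pow_le_one₀ (norm_nonneg q) hq.le
    nlinarith [norm_nonneg a]

theorem E_ne_zero {q : ℂ} (hq : ‖q‖ < 1) : E q ≠ 0 := by
  rw [E_eq_qp]
  exact qp_ne_zero hq hq

theorem qp_zero (a : ℂ) : qp a 0 = 1 - a := by
  rw [qp, tprod_eq_mulSingle 0 (fun k hk => by simp [hk])]
  simp

theorem E_zero : E 0 = 1 := by
  rw [E_eq_qp, qp_zero, sub_zero]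

theorem qp_dissection {q : ℂ} (a : ℂ) (hq : ‖q‖ < 1) (m : ℕ) [NeZero m] :
    qp a q = ∏ i : Fin m, qp (a * q ^ (i : ℕ)) (q ^ m) := by
  have h1 := (Nat.divModEquiv m).symm.hasProd_iff.mpr (multipliable_qp a hq).hasProd
  have h2 := h1.prod_fiberwise fun n => hasProd_fintype _
  have h3 := Multipliable.tprod_finsetProd (s := (univ : Finset (Fin m)))
    (f := fun (i : Fin m) (k : ℕ) => 1 - a * q ^ (i : ℕ) * (q ^ m) ^ k)
    fun i _ => multipliable_qp _ (norm_pow_lt_one hq (NeZero.ne m))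
  simp only [qp]
  rw [← h3, ← h2.tprod_eq]
  refine tprod_congr fun k => prod_congr rfl fun i _ => ?_
  simp only [Function.comp, Nat.divModEquiv_symm_apply]
  ring

theorem qp_two_dissection {q : ℂ} (a : ℂ) (hq : ‖q‖ < 1) :
    qp a q = qp a (q ^ 2) * qp (a * q) (q ^ 2) := by
  simpa [Fin.prod_univ_two] using qp_dissection a hq 2

theorem qp_five_dissection {q : ℂ} (a : ℂ) (hq : ‖q‖ < 1) :
    qp a q = qp a (q ^ 5) * qp (a * q) (q ^ 5) * qp (a * q ^ 2) (q ^ 5) *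
      qp (a * q ^ 3) (q ^ 5) * qp (a * q ^ 4) (q ^ 5) := by
  simpa [Fin.prod_univ_five] using qp_dissection a hq 5

theorem qp_mul_qp_neg {q : ℂ} (a : ℂ) (hq : ‖q‖ < 1) :
    qp a q * qp (-a) q = qp (a ^ 2) (q ^ 2) := by
  simp only [qp]
  rw [← (multipliable_qp a hq).tprod_mul (multipliable_qp (-a) hq)]
  exact tprod_congr fun k => by ring

theorem qp_eq_one_sub_mul {q : ℂ} (a : ℂ) (hq : ‖q‖ < 1) :
    qp a q = (1 - a) * qp (a * q) q := by
  have h := tprod_eq_zero_mul' (f := fun k : ℕ => 1 - a * q ^ k) <| by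
    simpa [pow_succ', mul_assoc] using multipliable_qp (a * q) hq
  simpa [qp, pow_succ', mul_assoc] using h

theorem continuousOn_qp : ContinuousOn (fun p : ℂ × ℂ => qp p.1 p.2) {p | ‖p.2‖ < 1} := by
  have hopen : IsOpen {p : ℂ × ℂ | ‖p.2‖ < 1} := isOpen_lt (by fun_prop) continuous_const
  have h : HasProdLocallyUniformlyOn (fun (k : ℕ) (p : ℂ × ℂ) => 1 + -(p.1 * p.2 ^ k))
      (fun p => ∏' k : ℕ, (1 + -(p.1 * p.2 ^ k))) {p | ‖p.2‖ < 1} := by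
    refine hasProdLocallyUniformlyOn_of_forall_compact hopen fun K hK hcK => ?_
    rcases K.eq_empty_or_nonempty with rfl | hne
    · simpa [hasProdUniformlyOn_iff_tendstoUniformlyOn] using tendstoUniformlyOn_empty
    obtain ⟨p, hp, hpK⟩ := hcK.exists_isMaxOn hne (f := fun p : ℂ × ℂ => ‖p.2‖) (by fun_prop)
    obtain ⟨p', -, hpK'⟩ := hcK.exists_isMaxOn hne (f := fun p : ℂ × ℂ => ‖p.1‖) (by fun_prop)
    refine ((summable_geometric_of_lt_one (norm_nonneg p.2) (hK hp)).mul_left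
      ‖p'.1‖).hasProdUniformlyOn_nat_one_add hcK (.of_forall fun k x hx => ?_)
      fun k => by fun_prop
    rw [norm_neg, norm_mul, norm_pow]
    gcongr
    · exact hpK' hx
    · exact hpK hx
  simp only [qp, sub_eq_add_neg]
  refine (hasProdLocallyUniformlyOn_iff_tendstoLocallyUniformlyOn.mp h).continuousOn
    (.of_forall fun s => ?_)
  fun_prop

theorem continuousOn_qp_pow (m : ℕ) {n : ℕ} (hn : n ≠ 0) :
    ContinuousOn (fun q : ℂ => qp (q ^ m) (q ^ n)) (Metric.ball 0 1) :=
  continuousOn_qp.comp (f := fun q : ℂ => (q ^ m, q ^ n)) (by fun_prop) fun q hq =>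
    norm_pow_lt_one (by simpa using hq) hn

theorem continuousOn_E_pow {n : ℕ} (hn : n ≠ 0) :
    ContinuousOn (fun q : ℂ => E (q ^ n)) (Metric.ball 0 1) := by
  simpa only [E_eq_qp] using continuousOn_qp_pow n hn

end Pochhammer

section TripleProduct

/-- The finite product `(q;q)_n`. -/
noncomputable def qFac (q : ℂ) (n : ℕ) : ℂ := ∏ i ∈ range n, (1 - q ^ (i + 1))

/-- `1 / (q;q)_k`, with the convention that it vanishes for negative `k`. -/
noncomputable def qFacInv (q : ℂ) (k : ℤ) : ℂ := if k < 0 then 0 else (qFac q k.toNat)⁻¹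

theorem qFacInv_of_neg (q : ℂ) {k : ℤ} (hk : k < 0) : qFacInv q k = 0 := if_pos hk

theorem qFacInv_natCast (q : ℂ) (n : ℕ) : qFacInv q n = (qFac q n)⁻¹ := by
  simp [qFacInv]

theorem qFac_succ (q : ℂ) (n : ℕ) : qFac q (n + 1) = qFac q n * (1 - q ^ (n + 1)) :=
  prod_range_succ _ _

theorem qFac_ne_zero {q : ℂ} (hq : ‖q‖ < 1) (n : ℕ) : qFac q n ≠ 0 := by
  refine prod_ne_zero_iff.mpr fun i _ h => ?_
  have h1 := norm_pow_lt_one hq (Nat.succ_ne_zero i)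
  rw [Nat.succ_eq_add_one, ← sub_eq_zero.mp h, norm_one] at h1
  exact lt_irrefl _ h1

theorem qFacInv_sub_one {q : ℂ} (hq : ‖q‖ < 1) (k : ℤ) :
    qFacInv q (k - 1) = (1 - q ^ k) * qFacInv q k := by
  rcases lt_trichotomy k 0 with hk | rfl | hk
  · rw [qFacInv_of_neg q hk, qFacInv_of_neg q (by lia), mul_zero]
  · rw [qFacInv_of_neg q (by simp), zpow_zero, sub_self, zero_mul]
  · obtain ⟨n, rfl⟩ : ∃ n : ℕ, k = (n + 1 : ℕ) := ⟨(k - 1).toNat, by lia⟩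
    have h1 := qFac_ne_zero hq (n + 1)
    rw [show ((n + 1 : ℕ) : ℤ) - 1 = n by simp, qFacInv_natCast, qFacInv_natCast, zpow_natCast]
    rw [qFac_succ] at h1 ⊢
    have h2 := left_ne_zero_of_mul h1
    have h3 := right_ne_zero_of_mul h1
    field_simp

/-- The coefficient of `z ^ n` in the finite Jacobi triple product. -/
noncomputable def tripleCoeff (x : ℂ) (N : ℕ) (n : ℤ) : ℂ :=
  qFac (x ^ 2) (2 * N) * (qFacInv (x ^ 2) (N + n) * qFacInv (x ^ 2) (N - n))

theorem tripleCoeff_succ {x : ℂ} (hx0 : x ≠ 0) (hx : ‖x‖ < 1) (N : ℕ) (n : ℤ) :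
    tripleCoeff x (N + 1) n * x ^ (n ^ 2) =
      (1 + x ^ (4 * N + 2)) * (tripleCoeff x N n * x ^ (n ^ 2)) +
        x ^ (2 * N + 1) * (tripleCoeff x N (n - 1) * x ^ ((n - 1) ^ 2) +
          tripleCoeff x N (n + 1) * x ^ ((n + 1) ^ 2)) := by
  have hq : ‖x ^ 2‖ < 1 := norm_pow_lt_one hx two_ne_zero
  have e := qFacInv_sub_one hq
  have e1 : qFacInv (x ^ 2) (N + n) = (1 - (x ^ 2) ^ (N + n + 1)) *
      qFacInv (x ^ 2) (N + n + 1) := by rw [← e]; ring_nf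
  have e2 : qFacInv (x ^ 2) (N + n - 1) = (1 - (x ^ 2) ^ (N + n)) *
      qFacInv (x ^ 2) (N + n) := e _
  have e3 : qFacInv (x ^ 2) (N - n) = (1 - (x ^ 2) ^ (N - n + 1)) *
      qFacInv (x ^ 2) (N - n + 1) := by rw [← e]; ring_nf
  have e4 : qFacInv (x ^ 2) (N - n - 1) = (1 - (x ^ 2) ^ (N - n)) *
      qFacInv (x ^ 2) (N - n) := e _
  have f : qFac (x ^ 2) (2 * (N + 1)) = qFac (x ^ 2) (2 * N) *
      (1 - (x ^ 2) ^ (2 * N + 1)) * (1 - (x ^ 2) ^ (2 * N + 2)) := by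
    rw [show 2 * (N + 1) = 2 * N + 1 + 1 by ring, qFac_succ, qFac_succ]
  have g1 : (↑(N + 1) + n : ℤ) = N + n + 1 := by push_cast; ring
  have g2 : (↑(N + 1) - n : ℤ) = N - n + 1 := by push_cast; ring
  have g3 : (N + (n - 1) : ℤ) = N + n - 1 := by ring
  have g4 : (N - (n - 1) : ℤ) = N - n + 1 := by ring
  have g5 : (N + (n + 1) : ℤ) = N + n + 1 := by ring
  have g6 : (N - (n + 1) : ℤ) = N - n - 1 := by ring
  simp only [tripleCoeff, g1, g2, g3, g4, g5, g6, f, e2, e4, e1, e3]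
  have hX : (x ^ 2) ^ ((N : ℤ) + n) = x ^ (2 * N) * x ^ n * x ^ n := by
    rw [zpow_add₀ (pow_ne_zero 2 hx0), zpow_natCast, ← pow_mul, ← zpow_natCast x 2, ← zpow_mul,
      mul_assoc, ← zpow_add₀ hx0]
    ring_nf
  have hY : (x ^ 2) ^ ((N : ℤ) - n) = x ^ (2 * N) * (x ^ n)⁻¹ * (x ^ n)⁻¹ := by
    rw [zpow_sub₀ (pow_ne_zero 2 hx0), zpow_natCast, ← pow_mul, ← zpow_natCast x 2, ← zpow_mul,
      div_eq_mul_inv, mul_assoc, ← mul_inv, ← zpow_add₀ hx0]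
    ring_nf
  rw [zpow_add₀ (pow_ne_zero 2 hx0), zpow_one, zpow_add₀ (pow_ne_zero 2 hx0) (N - n), zpow_one,
    hX, hY]
  have hu : x ^ n ≠ 0 := zpow_ne_zero _ hx0
  rw [show (n - 1) ^ 2 = n ^ 2 - n - n + 1 by ring, show (n + 1) ^ 2 = n ^ 2 + n + n + 1 by ring]
  simp only [zpow_add₀ hx0, zpow_sub₀ hx0, zpow_one]
  field_simp
  ring

theorem hasSum_finite_triple_product {x z : ℂ} (hx0 : x ≠ 0) (hx : ‖x‖ < 1) (hz : z ≠ 0) (N : ℕ) :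
    HasSum (fun n : ℤ => z ^ n * (tripleCoeff x N n * x ^ (n ^ 2)))
      (∏ k ∈ range N, ((1 + z * x ^ (2 * k + 1)) * (1 + z⁻¹ * x ^ (2 * k + 1)))) := by
  induction N with
  | zero =>
    have h : HasSum (fun n : ℤ => z ^ n * (tripleCoeff x 0 n * x ^ (n ^ 2))) _ :=
      hasSum_single 0 fun n hn => ?_
    · simpa [tripleCoeff, qFacInv, qFac] using h
    · rcases lt_or_gt_of_ne hn with hn | hn
      · simp [tripleCoeff, qFacInv_of_neg _ hn]
      · simp [tripleCoeff, qFacInv_of_neg _ (neg_lt_zero.mpr hn)]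
  | succ N ih =>
    have h1 := ((Equiv.subRight (1 : ℤ)).hasSum_iff.mpr ih).mul_left (z * x ^ (2 * N + 1))
    have h2 := ((Equiv.addRight (1 : ℤ)).hasSum_iff.mpr ih).mul_left (z⁻¹ * x ^ (2 * N + 1))
    convert! (ih.mul_left (1 + x ^ (4 * N + 2))).add (h1.add h2) using 1
    · ext n
      simp only [Function.comp, Equiv.subRight_apply, Equiv.coe_addRight,
        tripleCoeff_succ hx0 hx, zpow_sub₀ hz n, zpow_add₀ hz n, zpow_one]
      field_simp
    · rw [prod_range_succ]
      field_simp
      ring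

theorem summable_norm_zpow_mul_zpow_sq {x z : ℂ} (hx0 : x ≠ 0) (hx : ‖x‖ < 1) (hz : z ≠ 0) :
    Summable fun n : ℤ => ‖z ^ n * x ^ (n ^ 2)‖ := by
  have key : ∀ w : ℂ, w ≠ 0 → Summable fun n : ℕ => ‖w ^ n * x ^ (n ^ 2)‖ := by
    intro w hw
    have hlim : Tendsto (fun n : ℕ => ‖w‖ * ‖x‖ * (‖x‖ ^ 2) ^ n) atTop (𝓝 0) := by
      simpa using (tendsto_pow_atTop_nhds_zero_of_lt_one (by positivity)
        (pow_lt_one₀ (norm_nonneg x) hx two_ne_zero)).const_mul (‖w‖ * ‖x‖)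
    refine summable_of_ratio_test_tendsto_lt_one zero_lt_one (.of_forall fun n => ?_)
      (hlim.congr fun n => ?_)
    · simp [hw, hx0]
    · have := norm_ne_zero_iff.mpr hx0
      have := norm_ne_zero_iff.mpr hw
      simp only [norm_norm, norm_mul, norm_pow]
      rw [show (n + 1) ^ 2 = n ^ 2 + 2 * n + 1 by ring]
      field_simp
      ring
  refine .of_nat_of_neg ?_ ?_
  · simpa [← zpow_natCast] using key z hz
  · simpa [← zpow_natCast] using key z⁻¹ (inv_ne_zero hz)

theorem tendsto_qFac {q : ℂ} (hq : ‖q‖ < 1) : Tendsto (qFac q) atTop (𝓝 (E q)) :=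
  (ModularForm.multipliable_one_sub_pow hq).tendsto_prod_tprod_nat

theorem tendsto_qFacInv {q : ℂ} (hq : ‖q‖ < 1) {u : ℕ → ℤ} (hu : Tendsto u atTop atTop) :
    Tendsto (fun n => qFacInv q (u n)) atTop (𝓝 (E q)⁻¹) := by
  have h1 : Tendsto (fun n => (qFac q (u n).toNat)⁻¹) atTop (𝓝 (E q)⁻¹) :=
    ((tendsto_qFac hq).comp (tendsto_atTop.mpr fun b => ?_)).inv₀ (E_ne_zero hq)
  · refine h1.congr' ?_
    filter_upwards [hu.eventually_ge_atTop 0] with n hn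
    rw [qFacInv, if_neg hn.not_gt]
  · filter_upwards [hu.eventually_ge_atTop b] with n hn
    lia

theorem exists_norm_qFacInv_le {q : ℂ} (hq : ‖q‖ < 1) : ∃ C, ∀ k, ‖qFacInv q k‖ ≤ C := by
  have h := ((tendsto_qFac hq).inv₀ (E_ne_zero hq)).norm.bddAbove_range
  obtain ⟨C, hC⟩ := h
  refine ⟨C, fun k => ?_⟩
  have h0 : ∀ n, ‖(qFac q n)⁻¹‖ ≤ C := fun n => hC ⟨n, rfl⟩
  rw [qFacInv]
  split_ifs
  · simpa using (norm_nonneg _).trans (h0 0)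
  · exact h0 _

/-- The theta series `∑ z ^ n * x ^ (n ^ 2)` over the integers. -/
noncomputable def theta (z x : ℂ) : ℂ := ∑' n : ℤ, z ^ n * x ^ (n ^ 2)

/-- The Jacobi triple product identity. -/
theorem theta_eq {x z : ℂ} (hx0 : x ≠ 0) (hx : ‖x‖ < 1) (hz : z ≠ 0) :
    theta z x = E (x ^ 2) * qp (-(z * x)) (x ^ 2) * qp (-(z⁻¹ * x)) (x ^ 2) := by
  have hq : ‖x ^ 2‖ < 1 := norm_pow_lt_one hx two_ne_zero
  have hE := E_ne_zero hq
  obtain ⟨C, hC⟩ := exists_norm_qFacInv_le hq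
  obtain ⟨D, hD⟩ := (tendsto_qFac hq).norm.bddAbove_range
  have hC0 : 0 ≤ C := (norm_nonneg _).trans (hC 0)
  have hD0 : 0 ≤ D := (norm_nonneg _).trans (hD ⟨0, rfl⟩)
  have hprod (w : ℂ) : Tendsto (fun N => ∏ k ∈ range N, (1 + w * x ^ (2 * k + 1))) atTop
      (𝓝 (qp (-(w * x)) (x ^ 2))) := by
    refine ((multipliable_qp (-(w * x)) hq).tendsto_prod_tprod_nat).congr fun N =>
      prod_congr rfl fun k _ => ?_
    ring
  have h1 := ((hprod z).mul (hprod z⁻¹)).congr fun N => prod_mul_distrib.symm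
  have h2 : Tendsto (fun N => ∑' n : ℤ, z ^ n * (tripleCoeff x N n * x ^ (n ^ 2))) atTop
      (𝓝 (∑' n : ℤ, (E (x ^ 2))⁻¹ * (z ^ n * x ^ (n ^ 2)))) := by
    refine tendsto_tsum_of_dominated_convergence
      (bound := fun n : ℤ => D * (C * C) * ‖z ^ n * x ^ (n ^ 2)‖)
      ((summable_norm_zpow_mul_zpow_sq hx0 hx hz).mul_left _) (fun n => ?_)
      (.of_forall fun N n => ?_)
    · have hc : Tendsto (fun N => tripleCoeff x N n) atTop (𝓝 (E (x ^ 2))⁻¹) := by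
        have h3 := ((tendsto_qFac hq).comp (tendsto_id.const_mul_atTop' two_pos)).mul
          ((tendsto_qFacInv hq
            (tendsto_atTop_add_const_right _ n tendsto_natCast_atTop_atTop)).mul
          (tendsto_qFacInv hq
            (tendsto_atTop_add_const_right _ (-n) tendsto_natCast_atTop_atTop)))
        rw [mul_inv_cancel_left₀ hE] at h3
        exact h3
      convert! (hc.mul_const (x ^ (n ^ 2))).const_mul (z ^ n) using 2
      ring
    · rw [mul_left_comm, norm_mul, tripleCoeff, norm_mul, norm_mul]
      gcongr
      · exact hD ⟨_, rfl⟩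
      · exact hC _
      · exact hC _
  simp only [(hasSum_finite_triple_product hx0 hx hz _).tsum_eq] at h2
  have h4 := tendsto_nhds_unique h1 h2
  rw [tsum_mul_left] at h4
  rw [mul_assoc, h4, mul_inv_cancel_left₀ hE, theta]

end TripleProduct

section Lattice

theorem theta_inv (z x : ℂ) : theta z⁻¹ x = theta z x := by
  rw [theta, ← (Equiv.neg ℤ).tsum_eq]
  simp [theta]

theorem theta_mul_sq {z x : ℂ} (hz : z ≠ 0) (hx : x ≠ 0) :
    theta (z * x ^ 2) x = (z * x)⁻¹ * theta z x := by
  rw [theta, theta, ← (Equiv.addRight (1 : ℤ)).tsum_eq fun n : ℤ => z ^ n * x ^ (n ^ 2),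
    ← tsum_mul_left]
  refine tsum_congr fun n => ?_
  rw [Equiv.coe_addRight, mul_zpow, ← zpow_natCast x 2, ← zpow_mul,
    show (n + 1) ^ 2 = n ^ 2 + (2 : ℕ) * n + 1 by push_cast; ring]
  simp only [zpow_add₀ hx, zpow_add₀ hz, zpow_one]
  field_simp

theorem theta_neg_self {x : ℂ} (hx : x ≠ 0) : theta (-x) x = 0 := by
  have h := theta_mul_sq (inv_ne_zero (neg_ne_zero.mpr hx)) hx
  rw [theta_inv, show (-x)⁻¹ * x ^ 2 = -x by field_simp, show ((-x)⁻¹ * x)⁻¹ = -1 by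
    field_simp] at h
  linear_combination h / 2

theorem theta_mul_theta_of_equiv {ι : Type*} [Fintype ι] (e : ι × (ℤ × ℤ) ≃ ℤ × ℤ)
    {x y z w s t : ℂ} {a b c : ι → ℂ} (hx0 : x ≠ 0) (hx : ‖x‖ < 1) (hz : z ≠ 0)
    (hy0 : y ≠ 0) (hy : ‖y‖ < 1) (hw : w ≠ 0) (hs0 : s ≠ 0) (hs : ‖s‖ < 1) (ht0 : t ≠ 0)
    (ht : ‖t‖ < 1) (ha : ∀ i, a i ≠ 0) (hb : ∀ i, b i ≠ 0)
    (h : ∀ i (m n : ℤ), z ^ (e (i, m, n)).1 * x ^ ((e (i, m, n)).1 ^ 2) *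
      (w ^ (e (i, m, n)).2 * y ^ ((e (i, m, n)).2 ^ 2)) =
      c i * ((a i ^ m * s ^ (m ^ 2)) * (b i ^ n * t ^ (n ^ 2)))) :
    theta z x * theta w y = ∑ i, c i * (theta (a i) s * theta (b i) t) := by
  have hxy := summable_mul_of_summable_norm (summable_norm_zpow_mul_zpow_sq hx0 hx hz)
    (summable_norm_zpow_mul_zpow_sq hy0 hy hw)
  have hxy' := e.summable_iff.mpr hxy
  simp only [Function.comp_def] at hxy'
  rw [theta, theta, tsum_mul_tsum_of_summable_norm (summable_norm_zpow_mul_zpow_sq hx0 hx hz)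
    (summable_norm_zpow_mul_zpow_sq hy0 hy hw), ← e.tsum_eq, hxy'.tsum_prod, tsum_fintype]
  refine sum_congr rfl fun i _ => ?_
  rw [theta, theta, tsum_mul_tsum_of_summable_norm (summable_norm_zpow_mul_zpow_sq hs0 hs (ha i))
    (summable_norm_zpow_mul_zpow_sq ht0 ht (hb i)), ← tsum_mul_left]
  exact tsum_congr fun p => h i p.1 p.2

/-- The decomposition of `ℤ × ℤ` into the residue classes of `m - n` modulo `5`. -/
def subModFiveEquiv : Fin 5 × (ℤ × ℤ) ≃ ℤ × ℤ where
  toFun p := (p.2.1 + 4 * p.2.2 + ((p.1 : ℕ) - 2 : ℤ), p.2.1 - p.2.2)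
  invFun p := (⟨((p.1 - p.2 + 2) % 5).toNat, by lia⟩,
    (p.2 + (p.1 - p.2 + 2) / 5, (p.1 - p.2 + 2) / 5))
  left_inv := by
    rintro ⟨i, m, n⟩
    have hi := i.isLt
    simp only [Prod.mk.injEq, Fin.ext_iff]
    omega
  right_inv := by
    rintro ⟨m, n⟩
    simp only [Prod.mk.injEq]
    lia

/-- The decomposition of `ℤ × ℤ` into the residue classes of `m + 2 * n` modulo `5`. -/
def addTwoMulModFiveEquiv : Fin 5 × (ℤ × ℤ) ≃ ℤ × ℤ where
  toFun p := (p.2.1 + 2 * p.2.2 + ((p.1 : ℕ) - 2 : ℤ), 2 * p.2.1 - p.2.2)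
  invFun p := (⟨((p.1 + 2 * p.2 + 2) % 5).toNat, by lia⟩,
    ((p.1 + 2 * p.2 + 2) / 5, 2 * ((p.1 + 2 * p.2 + 2) / 5) - p.2))
  left_inv := by
    rintro ⟨i, m, n⟩
    have hi := i.isLt
    simp only [Prod.mk.injEq, Fin.ext_iff]
    omega
  right_inv := by
    rintro ⟨m, n⟩
    simp only [Prod.mk.injEq]
    lia

theorem theta_one_sq {q : ℂ} (hq0 : q ≠ 0) (hq : ‖q‖ < 1) :
    theta 1 q ^ 2 =
      theta 1 (q ^ 5) ^ 2 + 4 * q * (theta (q ^ 2) (q ^ 5) * theta (q ^ 4) (q ^ 5)) := by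
  have h5 := norm_pow_lt_one hq (n := 5) (by simp)
  have h50 := pow_ne_zero 5 hq0
  have h := theta_mul_theta_of_equiv addTwoMulModFiveEquiv hq0 hq one_ne_zero hq0 hq one_ne_zero
    h50 h5 h50 h5
    (a := fun i => q ^ (2 * ((i : ℕ) - 2 : ℤ))) (b := fun i => q ^ (4 * ((i : ℕ) - 2 : ℤ)))
    (c := fun i => q ^ (((i : ℕ) - 2 : ℤ) ^ 2))
    (fun i => zpow_ne_zero _ hq0) (fun i => zpow_ne_zero _ hq0) fun i m n => by
      simp only [addTwoMulModFiveEquiv, Equiv.coe_fn_mk, one_zpow, one_mul, ← zpow_natCast q 5,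
        ← zpow_mul, ← zpow_add₀ hq0]
      congr 1
      push_cast
      ring
  have h8 : theta (q ^ 8) (q ^ 5) = (q ^ 3)⁻¹ * theta (q ^ 2) (q ^ 5) := by
    have h := theta_mul_sq (inv_ne_zero (pow_ne_zero 2 hq0)) h50
    rwa [theta_inv, show (q ^ 2)⁻¹ * (q ^ 5) ^ 2 = q ^ 8 by field_simp,
      show (q ^ 2)⁻¹ * q ^ 5 = q ^ 3 by field_simp] at h
  simp only [Fin.sum_univ_five] at h
  norm_num [zpow_neg, theta_inv, zpow_ofNat] at h
  rw [h8] at h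
  rw [sq, h]
  field_simp
  ring

theorem theta_self_mul_theta_neg_one {t : ℂ} (ht0 : t ≠ 0) (ht : ‖t‖ < 1) :
    theta t t * theta (-1) (t ^ 4) =
      2 * (theta (-t) (t ^ 5) * theta (-t ^ 4) (t ^ 20) +
        t ^ 2 * (theta (-t ^ 3) (t ^ 5) * theta (-t ^ 12) (t ^ 20))) := by
  have hlt {n : ℕ} (hn : n ≠ 0) := norm_pow_lt_one ht hn
  have hne (n : ℕ) := pow_ne_zero n ht0
  have h := theta_mul_theta_of_equiv subModFiveEquiv ht0 ht ht0 (hne 4) (hlt (by simp))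
    (neg_ne_zero.mpr one_ne_zero) (hne 5) (hlt (by simp)) (hne 20) (hlt (by simp))
    (a := fun i => -t ^ (2 * ((i : ℕ) - 2 : ℤ) + 1))
    (b := fun i => -t ^ (4 * (2 * ((i : ℕ) - 2 : ℤ) + 1)))
    (c := fun i => t ^ (((i : ℕ) - 2 : ℤ) ^ 2 + ((i : ℕ) - 2 : ℤ)))
    (fun i => neg_ne_zero.mpr (zpow_ne_zero _ ht0))
    (fun i => neg_ne_zero.mpr (zpow_ne_zero _ ht0)) fun i m n => by
      simp only [subModFiveEquiv, Equiv.coe_fn_mk]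
      generalize ((i : ℕ) - 2 : ℤ) = r
      have hsign : (-1 : ℂ) ^ (m - n) = (-1) ^ m * (-1) ^ n := by
        rw [zpow_sub₀ (by simp), div_eq_mul_inv, ← inv_zpow, inv_neg, inv_one]
      rw [hsign, neg_eq_neg_one_mul (t ^ (2 * r + 1)), neg_eq_neg_one_mul (t ^ (4 * (2 * r + 1))),
        mul_zpow, mul_zpow]
      have hexp : t ^ (m + 4 * n + r) * t ^ ((m + 4 * n + r) ^ 2) * (t ^ 4) ^ ((m - n) ^ 2) =
          t ^ (r ^ 2 + r) * ((t ^ (2 * r + 1)) ^ m * (t ^ 5) ^ (m ^ 2) *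
            ((t ^ (4 * (2 * r + 1))) ^ n * (t ^ 20) ^ (n ^ 2))) := by
        simp only [← zpow_natCast t 4, ← zpow_natCast t 5, ← zpow_natCast t 20, ← zpow_mul,
          ← zpow_add₀ ht0]
        congr 1
        push_cast
        ring
      linear_combination (-1) ^ m * (-1) ^ n * hexp
  have h0 : theta (-t ^ 5) (t ^ 5) = 0 := theta_neg_self (hne 5)
  have hinv (n : ℕ) (x : ℂ) : theta (-(t ^ n)⁻¹) x = theta (-t ^ n) x := by
    rw [← inv_neg, theta_inv]
  have hinv1 (x : ℂ) : theta (-t⁻¹) x = theta (-t) x := by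
    rw [← inv_neg, theta_inv]
  simp only [Fin.sum_univ_five] at h
  norm_num [zpow_neg, hinv, hinv1, h0, zpow_ofNat] at h
  rw [h]
  ring

end Lattice

section EtaQuotients

theorem E_eq_qp_mul_E_sq {q : ℂ} (hq : ‖q‖ < 1) : E q = qp q (q ^ 2) * E (q ^ 2) := by
  rw [E_eq_qp, qp_two_dissection q hq, E_eq_qp, sq]

theorem qp_neg_sq_mul {q : ℂ} (hq : ‖q‖ < 1) :
    qp (-q) (q ^ 2) * (E q * E (q ^ 4)) = E (q ^ 2) ^ 2 := by
  have hq2 := norm_pow_lt_one hq two_ne_zero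
  have h1 := E_eq_qp_mul_E_sq hq
  have h2 := E_eq_qp_mul_E_sq hq2
  have h3 := qp_mul_qp_neg q hq2
  rw [← pow_mul] at h2 h3
  linear_combination qp (-q) (q ^ 2) * E (q ^ 4) * h1 + E (q ^ 2) * E (q ^ 4) * h3 -
    E (q ^ 2) * h2

theorem theta_one_mul {q : ℂ} (hq0 : q ≠ 0) (hq : ‖q‖ < 1) :
    theta 1 q * (E q * E (q ^ 4)) ^ 2 = E (q ^ 2) ^ 5 := by
  have h := qp_neg_sq_mul hq
  rw [theta_eq hq0 hq one_ne_zero, inv_one, one_mul]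
  linear_combination E (q ^ 2) * (qp (-q) (q ^ 2) * (E q * E (q ^ 4)) + E (q ^ 2) ^ 2) * h

theorem theta_neg_one_mul {q : ℂ} (hq0 : q ≠ 0) (hq : ‖q‖ < 1) :
    theta (-1) q * E (q ^ 2) = E q ^ 2 := by
  rw [theta_eq hq0 hq (neg_ne_zero.mpr one_ne_zero), inv_neg, inv_one, neg_one_mul, neg_neg,
    E_eq_qp_mul_E_sq hq]
  ring

theorem theta_self_mul {q : ℂ} (hq0 : q ≠ 0) (hq : ‖q‖ < 1) :
    theta q q * E (q ^ 2) = 2 * E (q ^ 4) ^ 2 := by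
  have hq2 := norm_pow_lt_one hq two_ne_zero
  have h1 := qp_eq_one_sub_mul (-1) hq2
  have h2 := qp_mul_qp_neg (q ^ 2) hq2
  rw [← E_eq_qp, ← E_eq_qp, ← pow_mul] at h2
  rw [theta_eq hq0 hq hq0, inv_mul_cancel₀ hq0, ← sq, h1, ← h2, neg_one_mul]
  ring

/-- The theta function `f(-q, -q^4)`. -/
noncomputable def thetaOne (q : ℂ) : ℂ := E (q ^ 5) * (qp q (q ^ 5) * qp (q ^ 4) (q ^ 5))

/-- The theta function `f(-q^2, -q^3)`. -/
noncomputable def thetaTwo (q : ℂ) : ℂ := E (q ^ 5) * (qp (q ^ 2) (q ^ 5) * qp (q ^ 3) (q ^ 5))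

theorem thetaOne_mul_thetaTwo {q : ℂ} (hq : ‖q‖ < 1) :
    thetaOne q * thetaTwo q = E q * E (q ^ 5) := by
  rw [E_eq_qp q, qp_five_dissection q hq, thetaOne, thetaTwo, E_eq_qp]
  ring_nf

theorem R_eq {q : ℂ} (hq : ‖q‖ < 1) : R q = thetaOne q / thetaTwo q := by
  rw [R, thetaOne, thetaTwo, mul_div_mul_left _ _ (E_ne_zero (norm_pow_lt_one hq (by simp)))]

theorem theta_neg_eq_thetaTwo {t : ℂ} (ht0 : t ≠ 0) (ht : ‖t‖ < 1) :
    theta (-t) (t ^ 5) = thetaTwo (t ^ 2) := by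
  rw [theta_eq (pow_ne_zero 5 ht0) (norm_pow_lt_one ht (by simp)) (neg_ne_zero.mpr ht0), thetaTwo,
    inv_neg, neg_mul, neg_neg, neg_mul, neg_neg, show t⁻¹ * t ^ 5 = t ^ 4 by field_simp]
  ring_nf

theorem theta_neg_eq_thetaOne {t : ℂ} (ht0 : t ≠ 0) (ht : ‖t‖ < 1) :
    theta (-t ^ 3) (t ^ 5) = thetaOne (t ^ 2) := by
  rw [theta_eq (pow_ne_zero 5 ht0) (norm_pow_lt_one ht (by simp))
    (neg_ne_zero.mpr (pow_ne_zero 3 ht0)), thetaOne, inv_neg, neg_mul, neg_neg, neg_mul, neg_neg,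
    show (t ^ 3)⁻¹ * t ^ 5 = t ^ 2 by field_simp]
  ring_nf

theorem thetaTwo_add_thetaOne {q : ℂ} (hq0 : q ≠ 0) (hq : ‖q‖ < 1) :
    (thetaTwo q * thetaTwo (q ^ 4) + q * (thetaOne q * thetaOne (q ^ 4))) * (E q * E (q ^ 4)) =
      E (q ^ 2) ^ 4 := by
  obtain ⟨t, rfl⟩ := IsAlgClosed.exists_pow_nat_eq q two_pos
  have ht0 : t ≠ 0 := fun h => hq0 (by simp [h])
  have ht : ‖t‖ < 1 := by
    rw [norm_pow] at hq
    exact lt_of_pow_lt_pow_left₀ 2 zero_le_one (by simpa using hq)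
  have ht4 := norm_pow_lt_one ht (n := 4) (by simp)
  have ht40 := pow_ne_zero 4 ht0
  have h := theta_self_mul_theta_neg_one ht0 ht
  have h1 := theta_neg_eq_thetaOne ht40 ht4
  have h2 := theta_neg_eq_thetaTwo ht40 ht4
  have h3 := theta_self_mul ht0 ht
  have h4 := theta_neg_one_mul ht40 ht4
  simp only [← pow_mul, Nat.reduceMul] at h1 h2 h4 ⊢
  rw [theta_neg_eq_thetaOne ht0 ht, theta_neg_eq_thetaTwo ht0 ht, h1, h2] at h
  linear_combination -(E (t ^ 2) * E (t ^ 8) / 2) * h +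
    theta (-1) (t ^ 4) * E (t ^ 8) / 2 * h3 + E (t ^ 4) ^ 2 * h4

theorem theta_sq_mul_theta_pow_four {q : ℂ} (hq0 : q ≠ 0) (hq : ‖q‖ < 1) :
    theta (q ^ 2) (q ^ 5) * theta (q ^ 4) (q ^ 5) * (E q * E (q ^ 4)) =
      E (q ^ 2) ^ 2 * (E (q ^ 5) * E (q ^ 20)) := by
  have hq5 := norm_pow_lt_one hq (n := 5) (by simp)
  have hq50 := pow_ne_zero 5 hq0
  have h1 := qp_neg_sq_mul hq
  have h2 := qp_neg_sq_mul hq5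
  have h3 := qp_five_dissection (-q) (norm_pow_lt_one hq two_ne_zero)
  rw [theta_eq hq50 hq5 (pow_ne_zero 2 hq0), theta_eq hq50 hq5 (pow_ne_zero 4 hq0),
    show (q ^ 2)⁻¹ * q ^ 5 = q ^ 3 by field_simp, show (q ^ 4)⁻¹ * q ^ 5 = q by field_simp,
    ← pow_add, ← pow_add]
  simp only [neg_mul, ← pow_mul, ← pow_succ', Nat.reduceMul, Nat.reduceAdd] at h1 h2 h3 ⊢
  linear_combination E (q ^ 5) * E (q ^ 20) * h1 -
    E (q ^ 5) * E (q ^ 20) * E q * E (q ^ 4) * h3 -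
    qp (-q) (q ^ 10) * qp (-q ^ 3) (q ^ 10) * qp (-q ^ 7) (q ^ 10) * qp (-q ^ 9) (q ^ 10) *
      E q * E (q ^ 4) * h2

theorem thetaTwo_sub_thetaOne_sq {q : ℂ} (hq0 : q ≠ 0) (hq : ‖q‖ < 1) :
    (thetaTwo q * thetaTwo (q ^ 4) - q * (thetaOne q * thetaOne (q ^ 4))) ^ 2 =
      (E (q ^ 10) ^ 5 * (E q * E (q ^ 4)) / ((E (q ^ 5) * E (q ^ 20)) ^ 2 * E (q ^ 2))) ^ 2 := by
  have hE {n : ℕ} (hn : n ≠ 0) := E_ne_zero (norm_pow_lt_one hq hn)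
  have e1 := E_ne_zero hq
  have e2 := hE (n := 2) (by simp)
  have e4 := hE (n := 4) (by simp)
  have e5 := hE (n := 5) (by simp)
  have e20 := hE (n := 20) (by simp)
  have hA := thetaTwo_add_thetaOne hq0 hq
  have h1 := thetaOne_mul_thetaTwo hq
  have h4 := thetaOne_mul_thetaTwo (norm_pow_lt_one hq (n := 4) (by simp))
  have hP := theta_one_mul hq0 hq
  have hP5 := theta_one_mul (pow_ne_zero 5 hq0) (norm_pow_lt_one hq (n := 5) (by simp))
  have hF := theta_sq_mul_theta_pow_four hq0 hq
  have hC := theta_one_sq hq0 hq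
  simp only [← pow_mul, Nat.reduceMul] at h4 hP5
  rw [← eq_div_iff (by positivity)] at hA hF hP
  rw [hP, hF] at hC
  have hN : (thetaTwo q * thetaTwo (q ^ 4) - q * (thetaOne q * thetaOne (q ^ 4))) ^ 2 =
      (E (q ^ 2) ^ 4 / (E q * E (q ^ 4))) ^ 2 -
        4 * q * (E q * E (q ^ 5) * (E (q ^ 4) * E (q ^ 20))) := by
    rw [← hA, ← h1, ← h4]
    ring
  have hM : E (q ^ 10) ^ 5 * (E q * E (q ^ 4)) / ((E (q ^ 5) * E (q ^ 20)) ^ 2 * E (q ^ 2)) =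
      theta 1 (q ^ 5) * (E q * E (q ^ 4)) / E (q ^ 2) := by
    rw [← hP5]
    field_simp
  rw [hN, hM, div_pow (theta 1 (q ^ 5) * _), mul_pow (theta 1 (q ^ 5)), eq_sub_of_add_eq hC.symm]
  field_simp

theorem continuousOn_thetaOne_pow {n : ℕ} (hn : n ≠ 0) :
    ContinuousOn (fun q : ℂ => thetaOne (q ^ n)) (Metric.ball 0 1) := by
  simp only [thetaOne, ← pow_mul]
  have hn5 : n * 5 ≠ 0 := by lia
  exact (continuousOn_E_pow hn5).mul
    ((continuousOn_qp_pow _ hn5).mul (continuousOn_qp_pow _ hn5))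

theorem continuousOn_thetaTwo_pow {n : ℕ} (hn : n ≠ 0) :
    ContinuousOn (fun q : ℂ => thetaTwo (q ^ n)) (Metric.ball 0 1) := by
  simp only [thetaTwo, ← pow_mul]
  have hn5 : n * 5 ≠ 0 := by lia
  exact (continuousOn_E_pow hn5).mul
    ((continuousOn_qp_pow _ hn5).mul (continuousOn_qp_pow _ hn5))

theorem thetaTwo_sub_thetaOne {q : ℂ} (hq : ‖q‖ < 1) :
    thetaTwo q * thetaTwo (q ^ 4) - q * (thetaOne q * thetaOne (q ^ 4)) =
      E (q ^ 10) ^ 5 * (E q * E (q ^ 4)) / ((E (q ^ 5) * E (q ^ 20)) ^ 2 * E (q ^ 2)) := by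
  have hE {n : ℕ} (hn : n ≠ 0) {x : ℂ} (hx : x ∈ Metric.ball (0 : ℂ) 1) : E (x ^ n) ≠ 0 :=
    E_ne_zero (norm_pow_lt_one (by simpa using hx) hn)
  have hE1 {x : ℂ} (hx : x ∈ Metric.ball (0 : ℂ) 1) : E x ≠ 0 := E_ne_zero (by simpa using hx)
  have hden {x : ℂ} (hx : x ∈ Metric.ball (0 : ℂ) 1) :
      (E (x ^ 5) * E (x ^ 20)) ^ 2 * E (x ^ 2) ≠ 0 := by
    simp [hE _ hx]
  have hc1 : ContinuousOn E (Metric.ball 0 1) := by simpa using continuousOn_E_pow one_ne_zero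
  have ht1 : ContinuousOn thetaOne (Metric.ball 0 1) := by
    simpa using continuousOn_thetaOne_pow one_ne_zero
  have ht2 : ContinuousOn thetaTwo (Metric.ball 0 1) := by
    simpa using continuousOn_thetaTwo_pow one_ne_zero
  have hzero : thetaTwo 0 * thetaTwo (0 ^ 4) - 0 * (thetaOne 0 * thetaOne (0 ^ 4)) =
      E (0 ^ 10) ^ 5 * (E 0 * E (0 ^ 4)) / ((E (0 ^ 5) * E (0 ^ 20)) ^ 2 * E (0 ^ 2)) := by
    simp [thetaTwo, E_zero, qp_zero]
  refine (convex_ball (0 : ℂ) 1).isPreconnected.eq_of_sq_eq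
    (f := fun q => thetaTwo q * thetaTwo (q ^ 4) - q * (thetaOne q * thetaOne (q ^ 4)))
    (g := fun q =>
      E (q ^ 10) ^ 5 * (E q * E (q ^ 4)) / ((E (q ^ 5) * E (q ^ 20)) ^ 2 * E (q ^ 2)))
    ?_ ?_ (fun x hx => ?_) (fun {x} hx => ?_) (Metric.mem_ball_self one_pos) hzero
    (by simpa using hq)
  · exact (ht2.mul (continuousOn_thetaTwo_pow (by simp))).sub
      (continuousOn_id.mul (ht1.mul (continuousOn_thetaOne_pow (by simp))))
  · exact ((continuousOn_E_pow (by simp)).pow 5 |>.mul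
      (hc1.mul (continuousOn_E_pow (by simp)))).div
      ((((continuousOn_E_pow (by simp)).mul (continuousOn_E_pow (by simp))).pow 2).mul
        (continuousOn_E_pow (by simp))) fun x hx => hden hx
  · rcases eq_or_ne x 0 with rfl | hx0
    · exact congrArg (· ^ 2) hzero
    · exact thetaTwo_sub_thetaOne_sq hx0 (by simpa using hx)
  · exact div_ne_zero (by simp [hE _ hx, hE1 hx]) (hden hx)

end EtaQuotients

theorem stmt_10 : ∀ q : ℂ, ‖q‖ < 1 →
    1 / (R q * R (q ^ 4)) - q ^ 2 * R q * R (q ^ 4)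
      = E (q ^ 2) ^ 3 * E (q ^ 10) ^ 5 / (E q * E (q ^ 4) * E (q ^ 5) ^ 3 * E (q ^ 20) ^ 3) := by
  intro q hq
  rcases eq_or_ne q 0 with rfl | hq0
  · simp [R, E_zero, qp_zero]
  have hq4 := norm_pow_lt_one hq (n := 4) (by simp)
  have hE {n : ℕ} (hn : n ≠ 0) := E_ne_zero (norm_pow_lt_one hq hn)
  have e1 := E_ne_zero hq
  have e2 := hE (n := 2) (by simp)
  have e4 := hE (n := 4) (by simp)
  have e5 := hE (n := 5) (by simp)
  have e20 := hE (n := 20) (by simp)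
  have hsum := thetaTwo_add_thetaOne hq0 hq
  have hsub := thetaTwo_sub_thetaOne hq
  have h1 := thetaOne_mul_thetaTwo hq
  have h4 := thetaOne_mul_thetaTwo hq4
  rw [← pow_mul] at h4
  have h1' := h1.trans_ne (mul_ne_zero e1 e5)
  have h4' := h4.trans_ne (mul_ne_zero e4 e20)
  have a1 := left_ne_zero_of_mul h1'
  have a2 := right_ne_zero_of_mul h1'
  have b1 := left_ne_zero_of_mul h4'
  have b2 := right_ne_zero_of_mul h4'
  rw [← eq_div_iff (mul_ne_zero e1 e4)] at hsum
  have key : 1 / (R q * R (q ^ 4)) - q ^ 2 * R q * R (q ^ 4) =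
      (thetaTwo q * thetaTwo (q ^ 4) + q * (thetaOne q * thetaOne (q ^ 4))) *
      (thetaTwo q * thetaTwo (q ^ 4) - q * (thetaOne q * thetaOne (q ^ 4))) /
      (thetaOne q * thetaTwo q * (thetaOne (q ^ 4) * thetaTwo (q ^ 4))) := by
    rw [R_eq hq, R_eq hq4]
    field_simp
    ring
  rw [key, hsum, hsub, h1, h4]
  field_simp
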